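/- Let p̃_N(z) = ∏_{j=1}^N (z + w_j) with each w_j on the unit circle, and let c(p̃_N) denote the closed linear span in H^2(𝔻) of {p̃_N·φ^λ : 0 ≤ λ ≤ δ}. Then c(p̃_N) + φ^δ·K_{z^N} = K_{z^{N+1}φ^δ}; in particular c(p̃_N) has codimension at most N in K_{z^{N+1}φ^δ}. -/

import Mathlib

open Complex MeasureTheory Metric Set

/-- Taylor coefficient at 0. -/
noncomputable def hcoeff (f : ℂ → ℂ) (n : ℕ) : ℂ := iteratedDeriv n f 0 / n.factorial

/-- H² inner product via Taylor coefficients (conjugate-linear in first slot). -/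
noncomputable def hinner (f g : ℂ → ℂ) : ℂ :=
  ∑' n : ℕ, (starRingEnd ℂ) (hcoeff f n) * hcoeff g n

/-- H² squared norm via Taylor coefficients. -/
noncomputable def hnormSq (f : ℂ → ℂ) : ℝ := ∑' n : ℕ, ‖hcoeff f n‖ ^ 2

/-- Membership in the Hardy space H²(𝔻). -/
def MemH2 (f : ℂ → ℂ) : Prop :=
  DifferentiableOn ℂ f (ball 0 1) ∧ Summable fun n : ℕ => ‖hcoeff f n‖ ^ 2

/-- Inner function on the unit disc. -/
def IsInner (u : ℂ → ℂ) : Prop :=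
  DifferentiableOn ℂ u (ball 0 1) ∧ (∀ z ∈ ball (0 : ℂ) 1, ‖u z‖ ≤ 1) ∧
    ∀ᵐ t : ℝ, Filter.Tendsto (fun r : ℝ => ‖u ((r : ℂ) * Complex.exp (Complex.I * t))‖)
      (nhdsWithin 1 (Set.Iio 1)) (nhds 1)

/-- Membership in the model space K_u = H² ⊖ uH². -/
def MemK (u f : ℂ → ℂ) : Prop :=
  MemH2 f ∧ ∀ g, MemH2 g → hinner (fun z => u z * g z) f = 0

/-- The powers of the atomic singular inner function. -/
noncomputable def phi (lam : ℝ) (z : ℂ) : ℂ := Complex.exp (-(lam : ℂ) * (1 - z) / (1 + z))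

/-- Membership in the closed linear span of a family {F λ : λ ∈ A} in H². -/
def InClosedSpan (F : ℝ → ℂ → ℂ) (A : Set ℝ) (f : ℂ → ℂ) : Prop :=
  MemH2 f ∧ ∀ ε > 0, ∃ (n : ℕ) (c : Fin n → ℂ) (lam : Fin n → ℝ),
    (∀ i, lam i ∈ A) ∧ hnormSq (fun z => f z - ∑ i, c i * F (lam i) z) < ε

open AddCircle Filter Topology ComplexConjugate

/-- The circle of length one. -/
abbrev Cc := AddCircle (1 : ℝ)

/-- Normalised Haar measure. -/
noncomputable abbrev mm : Measure Cc := haarAddCircle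

/-- The boundary variable. -/
noncomputable def ee (x : Cc) : ℂ := fourier 1 x

lemma fourier_eq_ee (n : ℤ) (x : Cc) : fourier n x = ee x ^ n := by
  simp [ee, fourier_apply, AddCircle.toCircle_zsmul]

lemma norm_ee (x : Cc) : ‖ee x‖ = 1 := by
  rw [ee, fourier_one]
  exact Circle.norm_coe _

lemma ee_ne_zero (x : Cc) : ee x ≠ 0 := by
  intro h
  have := norm_ee x
  simp [h] at this

lemma continuous_ee : Continuous ee := (fourier 1).continuous

lemma measurable_ee : Measurable ee := continuous_ee.measurable

lemma conj_ee (x : Cc) : conj (ee x) = (ee x)⁻¹ := by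
  rw [Complex.inv_eq_conj (norm_ee x)]

lemma ee_injective : Function.Injective ee := by
  intro x y h
  simp only [ee, fourier_one] at h
  exact AddCircle.injective_toCircle one_ne_zero (Subtype.ext h)

lemma ae_ee_ne : ∀ᵐ x ∂mm, ee x ≠ -1 := by
  have h : (ee ⁻¹' {-1}).Subsingleton := by
    intro x hx y hy
    exact ee_injective (by rw [hx, hy])
  have h2 : mm (ee ⁻¹' {-1}) = 0 := by
    have hv : mm = (volume : Measure Cc) := by
      rw [volume_eq_smul_haarAddCircle]
      simp
    rcases h.eq_empty_or_singleton with h | ⟨x, h⟩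
    · simp [h]
    · rw [h, hv, ← Metric.closedBall_zero, AddCircle.volume_closedBall]
      simp
  exact measure_eq_zero_iff_ae_notMem.mp h2

/-- Fourier coefficients. -/
noncomputable def cf (F : Cc → ℂ) (n : ℤ) : ℂ := ∫ x, (ee x ^ n)⁻¹ * F x ∂mm

lemma cf_eq (F : Cc → ℂ) (n : ℤ) : cf F n = fourierCoeff F n := by
  simp only [cf, fourierCoeff, fourier_eq_ee, zpow_neg, smul_eq_mul]

lemma inner_toLp {F G : Cc → ℂ} (hF : MemLp F 2 mm) (hG : MemLp G 2 mm) :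
    inner ℂ (hF.toLp F) (hG.toLp G) = ∫ x, conj (F x) * G x ∂mm := by
  rw [MeasureTheory.L2.inner_def]
  apply integral_congr_ae
  filter_upwards [hF.coeFn_toLp, hG.coeFn_toLp] with x h1 h2
  rw [h1, h2, RCLike.inner_apply']

lemma repr_toLp {F : Cc → ℂ} (hF : MemLp F 2 mm) (n : ℤ) :
    fourierBasis.repr (hF.toLp F) n = cf F n := by
  rw [fourierBasis_repr, cf_eq, fourierCoeff_congr_ae hF.coeFn_toLp]

lemma parseval {F G : Cc → ℂ} (hF : MemLp F 2 mm) (hG : MemLp G 2 mm) :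
    HasSum (fun n : ℤ => conj (cf F n) * cf G n) (∫ x, conj (F x) * G x ∂mm) := by
  rw [← inner_toLp hF hG]
  have := (fourierBasis (T := 1)).hasSum_inner_mul_inner (hF.toLp F) (hG.toLp G)
  have e : (fun n : ℤ => conj (cf F n) * cf G n) = fun i =>
      inner ℂ (hF.toLp F) (fourierBasis i) * inner ℂ (fourierBasis i) (hG.toLp G) := by
    ext n
    rw [← repr_toLp hF, ← repr_toLp hG, HilbertBasis.repr_apply_apply,
      HilbertBasis.repr_apply_apply, inner_conj_symm]
  rw [e]
  exact this

/-- `F` is the boundary function of `f`. -/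
def Bd (f : ℂ → ℂ) (F : Cc → ℂ) : Prop :=
  DifferentiableOn ℂ f (ball 0 1) ∧ MemLp F 2 mm ∧ (∀ n : ℕ, cf F n = hcoeff f n) ∧
    ∀ n : ℤ, n < 0 → cf F n = 0

lemma hasSum_nat {F : ℤ → ℂ} {a : ℂ} (h : HasSum F a) (h0 : ∀ n < 0, F n = 0) :
    HasSum (fun n : ℕ => F n) a := by
  have := (Function.Injective.hasSum_iff (f := F) (a := a) (Nat.cast_injective (R := ℤ)) (by
    intro x hx
    apply h0
    by_contra hc
    push Not at hc
    exact hx ⟨x.toNat, by simpa using hc⟩)).mpr h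
  exact this

lemma Bd.hasSum {f g : ℂ → ℂ} {F G : Cc → ℂ} (h : Bd f F) (h' : Bd g G) :
    HasSum (fun n : ℕ => conj (hcoeff f n) * hcoeff g n) (∫ x, conj (F x) * G x ∂mm) := by
  have := hasSum_nat (parseval h.2.1 h'.2.1) (by
    intro n hn
    simp [h'.2.2.2 n hn])
  simpa only [h.2.2.1, h'.2.2.1] using this

lemma Bd.hinner {f g : ℂ → ℂ} {F G : Cc → ℂ} (h : Bd f F) (h' : Bd g G) :
    hinner f g = ∫ x, conj (F x) * G x ∂mm := (h.hasSum h').tsum_eq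

lemma Bd.hasSum_sq {f : ℂ → ℂ} {F : Cc → ℂ} (h : Bd f F) :
    HasSum (fun n : ℕ => ‖hcoeff f n‖ ^ 2) (‖h.2.1.toLp F‖ ^ 2) := by
  have h1 := h.hasSum h
  rw [← inner_toLp h.2.1 h.2.1, inner_self_eq_norm_sq_to_K] at h1
  have h2 := Complex.hasSum_re h1
  convert h2 using 1
  · ext n
    rw [← Complex.normSq_eq_conj_mul_self, Complex.ofReal_re, Complex.normSq_eq_norm_sq]
  · norm_cast

lemma Bd.hnormSq {f : ℂ → ℂ} {F : Cc → ℂ} (h : Bd f F) :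
    hnormSq f = ‖h.2.1.toLp F‖ ^ 2 := h.hasSum_sq.tsum_eq

lemma Bd.memH2 {f : ℂ → ℂ} {F : Cc → ℂ} (h : Bd f F) : MemH2 f := ⟨h.1, h.hasSum_sq.summable⟩

lemma MemH2.exists_bd {f : ℂ → ℂ} (h : MemH2 f) : ∃ F, Bd f F := by
  let a : ℤ → ℂ := fun n => if n < 0 then 0 else hcoeff f n.toNat
  have ha : Memℓp a 2 := by
    apply memℓp_gen
    have : Summable fun n : ℤ => ‖a n‖ ^ 2 := by
      apply (Function.Injective.summable_iff (Nat.cast_injective (R := ℤ)) (by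
        intro x hx
        have : x < 0 := by
          by_contra hc
          push Not at hc
          exact hx ⟨x.toNat, by simpa using hc⟩
        simp [a, this])).mp
      refine h.2.congr ?_
      intro n
      have : ¬ ((n : ℤ) < 0) := by omega
      simp [a, this]
    simpa using this
  let A : lp (fun _ : ℤ => ℂ) 2 := ⟨a, ha⟩
  let F := (fourierBasis (T := 1)).repr.symm A
  have hc : ∀ n, cf F n = a n := by
    intro n
    rw [cf_eq, ← fourierBasis_repr]
    simp [F, A]
  refine ⟨F, h.1, Lp.memLp F, ?_, ?_⟩
  · intro n
    rw [hc]
    simp [a]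
  · intro n hn
    rw [hc]
    simp [a, hn]

lemma hcoeff_contDiff {f : ℂ → ℂ} (h : DifferentiableOn ℂ f (ball 0 1)) (n : ℕ∞) :
    ContDiffAt ℂ n f 0 :=
  (h.analyticAt (ball_mem_nhds 0 one_pos)).contDiffAt

lemma hcoeff_add {f g : ℂ → ℂ} (hf : DifferentiableOn ℂ f (ball 0 1))
    (hg : DifferentiableOn ℂ g (ball 0 1)) (n : ℕ) :
    hcoeff (fun z => f z + g z) n = hcoeff f n + hcoeff g n := by
  unfold hcoeff
  have := iteratedDeriv_add (hcoeff_contDiff hf n) (hcoeff_contDiff hg n)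
  rw [← add_div, ← this]
  rfl

lemma hcoeff_const_mul {f : ℂ → ℂ} (c : ℂ) (n : ℕ) :
    hcoeff (fun z => c * f z) n = c * hcoeff f n := by
  unfold hcoeff
  rw [iteratedDeriv_const_mul_field, mul_div_assoc]

lemma hcoeff_mul {f g : ℂ → ℂ} (hf : DifferentiableOn ℂ f (ball 0 1))
    (hg : DifferentiableOn ℂ g (ball 0 1)) (n : ℕ) :
    hcoeff (fun z => f z * g z) n
      = ∑ i ∈ Finset.range (n + 1), hcoeff f i * hcoeff g (n - i) := by
  unfold hcoeff
  have := iteratedDeriv_mul (hcoeff_contDiff hf n) (hcoeff_contDiff hg n)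
  change iteratedDeriv n (f * g) 0 / _ = _
  rw [this, Finset.sum_div]
  apply Finset.sum_congr rfl
  intro i hi
  have hi' : i ≤ n := by simpa [Nat.lt_succ_iff] using hi
  rw [Nat.cast_choose ℂ hi']
  have h1 : (n.factorial : ℂ) ≠ 0 := by exact_mod_cast n.factorial_ne_zero
  have h2 : (i.factorial : ℂ) ≠ 0 := by exact_mod_cast i.factorial_ne_zero
  have h3 : ((n - i).factorial : ℂ) ≠ 0 := by exact_mod_cast (n - i).factorial_ne_zero
  field_simp

lemma integrable_of_memLp2 {F : Cc → ℂ} (h : MemLp F 2 mm) : Integrable F mm :=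
  h.integrable (by norm_num)

lemma cf_integrable {F : Cc → ℂ} (h : Integrable F mm) (n : ℤ) :
    Integrable (fun x => (ee x ^ n)⁻¹ * F x) mm := by
  have := h.fourier_smul (-n)
  simpa only [fourier_eq_ee, zpow_neg, smul_eq_mul] using this

lemma Bd.add {f g : ℂ → ℂ} {F G : Cc → ℂ} (h : Bd f F) (h' : Bd g G) :
    Bd (fun z => f z + g z) (F + G) := by
  have hc : ∀ n, cf (F + G) n = cf F n + cf G n := by
    intro n
    simp only [cf]
    rw [← integral_add (cf_integrable (integrable_of_memLp2 h.2.1) n)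
      (cf_integrable (integrable_of_memLp2 h'.2.1) n)]
    simp [mul_add]
  refine ⟨h.1.add h'.1, h.2.1.add h'.2.1, ?_, ?_⟩
  · intro n
    rw [hc, h.2.2.1, h'.2.2.1, hcoeff_add h.1 h'.1]
  · intro n hn
    rw [hc, h.2.2.2 n hn, h'.2.2.2 n hn, add_zero]

lemma Bd.const_mul {f : ℂ → ℂ} {F : Cc → ℂ} (h : Bd f F) (c : ℂ) :
    Bd (fun z => c * f z) (c • F) := by
  have hc : ∀ n, cf (c • F) n = c * cf F n := by
    intro n
    simp only [cf]
    rw [← integral_const_mul]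
    congr 1
    ext x
    simp only [Pi.smul_apply, smul_eq_mul]
    ring
  refine ⟨h.1.const_mul c, h.2.1.const_smul c, ?_, ?_⟩
  · intro n
    rw [hc, h.2.2.1, hcoeff_const_mul]
  · intro n hn
    rw [hc, h.2.2.2 n hn, mul_zero]

lemma Bd.sub {f g : ℂ → ℂ} {F G : Cc → ℂ} (h : Bd f F) (h' : Bd g G) :
    Bd (fun z => f z - g z) (F - G) := by
  have := h.add (h'.const_mul (-1))
  convert this using 1
  · ext z; ring
  · ext x; simp [sub_eq_add_neg]

lemma Bd.zero : Bd (fun _ => 0) 0 := by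
  refine ⟨by fun_prop, MemLp.zero, ?_, ?_⟩
  · intro n
    simp [cf, hcoeff]
  · intro n hn
    simp [cf]

lemma Bd.sum {n : ℕ} (f : Fin n → ℂ → ℂ) (F : Fin n → Cc → ℂ) (h : ∀ i, Bd (f i) (F i)) :
    Bd (fun z => ∑ i, f i z) (∑ i, F i) := by
  induction n with
  | zero => simpa using Bd.zero
  | succ n ih =>
    simp only [Fin.sum_univ_succ]
    exact (h 0).add (ih _ _ fun i => h i.succ)

/-- Bounded multipliers with good boundary behaviour. -/
def Nice (u : ℂ → ℂ) : Prop :=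
  (∀ z, z ≠ -1 → DifferentiableAt ℂ u z) ∧ (∃ C, ∀ z, ‖z‖ ≤ 1 → ‖u z‖ ≤ C) ∧ Measurable u

lemma Nice.diffOn {u : ℂ → ℂ} (h : Nice u) : DifferentiableOn ℂ u (ball 0 1) := by
  intro z hz
  refine (h.1 z ?_).differentiableWithinAt
  rintro rfl
  simp at hz

lemma Nice.mul {u v : ℂ → ℂ} (hu : Nice u) (hv : Nice v) : Nice (fun z => u z * v z) := by
  refine ⟨fun z hz => (hu.1 z hz).mul (hv.1 z hz), ?_, hu.2.2.mul hv.2.2⟩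
  obtain ⟨C, hC⟩ := hu.2.1
  obtain ⟨D, hD⟩ := hv.2.1
  refine ⟨C * D, fun z hz => ?_⟩
  rw [norm_mul]
  exact mul_le_mul (hC z hz) (hD z hz) (norm_nonneg _) ((norm_nonneg _).trans (hC z hz))

lemma nice_const (c : ℂ) : Nice (fun _ => c) :=
  ⟨fun _ _ => by fun_prop, ⟨‖c‖, fun _ _ => le_rfl⟩, measurable_const⟩

lemma nice_add_const (c : ℂ) : Nice (fun z => z + c) := by
  refine ⟨fun _ _ => by fun_prop, ⟨1 + ‖c‖, fun z hz => ?_⟩, by fun_prop⟩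
  exact (norm_add_le _ _).trans (by gcongr)

lemma nice_pow (n : ℕ) : Nice (fun z => z ^ n) := by
  refine ⟨fun _ _ => by fun_prop, ⟨1, fun z hz => ?_⟩, by fun_prop⟩
  rw [norm_pow]
  exact pow_le_one₀ (norm_nonneg _) hz

lemma nice_prod {N : ℕ} (w : Fin N → ℂ) : Nice (fun z => ∏ j, (z + w j)) := by
  induction N with
  | zero => simpa using nice_const 1
  | succ n ih =>
    simp only [Fin.prod_univ_succ]
    exact (nice_add_const _).mul (ih _)

lemma phi_re (z : ℂ) : ((1 - z) / (1 + z)).re = (1 - ‖z‖ ^ 2) / ‖1 + z‖ ^ 2 := by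
  rw [Complex.div_re, ← Complex.normSq_eq_norm_sq, ← Complex.normSq_eq_norm_sq]
  rw [← add_div]
  congr 1
  simp [Complex.normSq_apply]
  ring

lemma norm_phi (lam : ℝ) (z : ℂ) :
    ‖phi lam z‖ = Real.exp (-lam * ((1 - ‖z‖ ^ 2) / ‖1 + z‖ ^ 2)) := by
  rw [phi, Complex.norm_exp, mul_div_assoc, ← phi_re, ← Complex.ofReal_neg, Complex.re_ofReal_mul]

lemma norm_phi_le {lam : ℝ} (h : 0 ≤ lam) {z : ℂ} (hz : ‖z‖ ≤ 1) : ‖phi lam z‖ ≤ 1 := by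
  rw [norm_phi, Real.exp_le_one_iff]
  have : 0 ≤ 1 - ‖z‖ ^ 2 := by nlinarith [norm_nonneg z]
  have : 0 ≤ lam * ((1 - ‖z‖ ^ 2) / ‖1 + z‖ ^ 2) := by positivity
  linarith

lemma norm_phi_ee (lam : ℝ) (x : Cc) : ‖phi lam (ee x)‖ = 1 := by
  rw [norm_phi, norm_ee]
  simp

lemma phi_add (a b : ℝ) (z : ℂ) : phi (a + b) z = phi a z * phi b z := by
  rw [phi, phi, phi, ← Complex.exp_add]
  congr 1
  push_cast
  ring

lemma phi_zero (z : ℂ) : phi 0 z = 1 := by simp [phi]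

lemma nice_phi {lam : ℝ} (h : 0 ≤ lam) : Nice (phi lam) := by
  refine ⟨fun z hz => ?_, ⟨1, fun z hz => norm_phi_le h hz⟩, ?_⟩
  · have : 1 + z ≠ 0 := by
      intro h
      exact hz (by linear_combination h)
    unfold phi
    fun_prop (disch := assumption)
  · unfold phi
    fun_prop

lemma Nice.memLp {u : ℂ → ℂ} (h : Nice u) : MemLp (fun x => u (ee x)) ⊤ mm := by
  obtain ⟨C, hC⟩ := h.2.1
  exact memLp_top_of_bound (h.2.2.comp measurable_ee).aestronglyMeasurable C
    (ae_of_all _ fun x => hC _ (norm_ee x).le)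

lemma Nice.mul_memLp {u : ℂ → ℂ} (h : Nice u) {F : Cc → ℂ} (hF : MemLp F 2 mm) :
    MemLp (fun x => u (ee x) * F x) 2 mm := by
  exact hF.mul (r := 2) h.memLp

lemma cf_pow (k n : ℤ) : cf (fun x => ee x ^ k) n = if k = n then 1 else 0 := by
  have h : cf (fun x => ee x ^ k) n = ∫ x, fourier (k - n) x ∂mm := by
    unfold cf
    congr 1
    ext x
    rw [fourier_eq_ee, zpow_sub₀ (ee_ne_zero x)]
    field_simp
  have h2 := congrFun (fourierCoeff_fourier (T := 1) k) n
  rw [← cf_eq] at h2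
  have h3 : ((fourier k : C(AddCircle (1 : ℝ), ℂ)) : Cc → ℂ) = fun x => ee x ^ k := by
    ext x
    rw [fourier_eq_ee]
  rw [h3] at h2
  rw [h2, Pi.single_apply]
  simp [eq_comm]

lemma nice_cf_r {u : ℂ → ℂ} (h : DifferentiableOn ℂ u (ball 0 1)) {r : ℝ} (hr0 : 0 ≤ r)
    (hr : r < 1) (n : ℤ) :
    cf (fun x => u (r * ee x)) n = if n < 0 then 0 else hcoeff u n.toNat * r ^ n.toNat := by
  have hs : ∀ z ∈ ball (0 : ℂ) 1, HasSum (fun k : ℕ => hcoeff u k * z ^ k) (u z) := by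
    intro z hz
    have := Complex.hasSum_taylorSeries_on_ball h hz
    have e : (fun k : ℕ => hcoeff u k * z ^ k)
        = fun n : ℕ => ((n.factorial : ℂ))⁻¹ • (z - 0) ^ n • iteratedDeriv n u 0 := by
      ext k
      simp only [hcoeff, sub_zero, smul_eq_mul]
      ring
    rw [e]
    exact this
  have hrb : (r : ℂ) ∈ ball (0 : ℂ) 1 := by simpa [abs_of_nonneg hr0] using hr
  have hsum : Summable fun k : ℕ => ‖hcoeff u k * r ^ k‖ := (hs r hrb).summable.norm
  have h1 : HasSum (fun k : ℕ => ∫ x, (ee x ^ n)⁻¹ * (hcoeff u k * (r * ee x) ^ k) ∂mm)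
      (cf (fun x => u (r * ee x)) n) := by
    have := hasSum_integral_of_summable_integral_norm (μ := mm)
      (F := fun (k : ℕ) x => (ee x ^ n)⁻¹ * (hcoeff u k * (r * ee x) ^ k)) ?_ ?_
    · have e : cf (fun x => u (r * ee x)) n
          = ∫ x, ∑' k : ℕ, (ee x ^ n)⁻¹ * (hcoeff u k * (r * ee x) ^ k) ∂mm := by
        unfold cf
        congr 1
        ext x
        rw [tsum_mul_left]
        congr 1
        refine ((hs _ ?_).tsum_eq).symm
        simpa [abs_of_nonneg hr0, norm_ee] using hr
      rw [e]
      exact this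
    · intro k
      apply cf_integrable
      apply Continuous.integrable_of_hasCompactSupport
      · have := continuous_ee
        fun_prop
      · exact HasCompactSupport.of_compactSpace _
    · refine hsum.congr ?_
      intro k
      simp [norm_ee]
  have h2 : ∀ k : ℕ, ∫ x, (ee x ^ n)⁻¹ * (hcoeff u k * (r * ee x) ^ k) ∂mm
      = hcoeff u k * r ^ k * (if (k : ℤ) = n then 1 else 0) := by
    intro k
    rw [← cf_pow, cf, ← integral_const_mul]
    congr 1
    ext x
    rw [mul_pow, zpow_natCast]
    ring
  simp only [h2] at h1
  rw [← h1.tsum_eq]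
  split_ifs with hn
  · convert tsum_zero with k
    have : (k : ℤ) ≠ n := by omega
    simp [this]
  · rw [tsum_eq_single n.toNat]
    · simp [not_lt.mp hn]
    · intro k hk
      have : (k : ℤ) ≠ n := by omega
      simp [this]

lemma Nice.cf {u : ℂ → ℂ} (h : Nice u) (n : ℤ) :
    cf (fun x => u (ee x)) n = if n < 0 then 0 else hcoeff u n.toNat := by
  obtain ⟨C, hC⟩ := h.2.1
  let r : ℕ → ℝ := fun k => 1 - 1 / ((k : ℝ) + 1)
  have hr0 : ∀ k, 0 ≤ r k := by
    intro k
    have : 1 / ((k : ℝ) + 1) ≤ 1 := by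
      rw [div_le_one (by positivity)]
      linarith [(Nat.cast_nonneg k : (0 : ℝ) ≤ k)]
    simp only [r]
    linarith
  have hr1 : ∀ k, r k < 1 := by
    intro k
    have : 0 < 1 / ((k : ℝ) + 1) := by positivity
    simp only [r]
    linarith
  have hrt : Tendsto r atTop (𝓝 1) := by
    have := tendsto_one_div_add_atTop_nhds_zero_nat (𝕜 := ℝ)
    simpa [r] using this.const_sub 1
  have hrt' : Tendsto (fun k => (r k : ℂ)) atTop (𝓝 1) := by
    have := (Complex.continuous_ofReal.tendsto 1).comp hrt
    rw [Complex.ofReal_one] at this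
    exact this
  have h1 : Tendsto (fun k => _root_.cf (fun x => u (r k * ee x)) n) atTop
      (𝓝 (_root_.cf (fun x => u (ee x)) n)) := by
    unfold _root_.cf
    refine tendsto_integral_of_dominated_convergence (fun _ => C) ?_ ?_ ?_ ?_
    · intro k
      apply Measurable.aestronglyMeasurable
      have h1 := measurable_ee
      have h2 := h.2.2
      fun_prop
    · exact integrable_const _
    · intro k
      refine ae_of_all _ fun x => ?_
      rw [norm_mul, norm_inv, norm_zpow, norm_ee]
      simp only [one_zpow, inv_one, one_mul]
      apply hC
      rw [norm_mul, norm_ee, Complex.norm_real, Real.norm_of_nonneg (hr0 k), mul_one]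
      exact (hr1 k).le
    · filter_upwards [ae_ee_ne] with x hx
      refine Tendsto.const_mul _ ?_
      have h2 := (h.1 _ hx).continuousAt
      refine h2.tendsto.comp ?_
      simpa using hrt'.mul_const (ee x)
  refine tendsto_nhds_unique h1 ?_
  simp only [nice_cf_r h.diffOn (hr0 _) (hr1 _)]
  split_ifs with hn
  · exact tendsto_const_nhds
  · simpa using (hrt'.pow n.toNat).const_mul (hcoeff u n.toNat)

lemma Nice.bd {u : ℂ → ℂ} (h : Nice u) : Bd u (fun x => u (ee x)) := by
  refine ⟨h.diffOn, h.memLp.mono_exponent le_top, ?_, ?_⟩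
  · intro n
    rw [h.cf]
    simp
  · intro n hn
    rw [h.cf]
    simp [hn]

lemma Bd.mul {u f : ℂ → ℂ} {F : Cc → ℂ} (hu : Nice u) (h : Bd f F) :
    Bd (fun z => u z * f z) (fun x => u (ee x) * F x) := by
  have hc : ∀ k : ℤ, HasSum (fun n : ℕ => cf (fun x => u (ee x)) n * cf F (k - n))
      (cf (fun x => u (ee x) * F x) k) := by
    intro k
    have hG : MemLp (fun x => ee x ^ k * conj (F x)) 2 mm := by
      refine (h.2.1.star).mul (r := 2) (p := ⊤) ?_
      refine memLp_top_of_bound ?_ 1 (ae_of_all _ fun x => ?_)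
      · exact (measurable_ee.pow_const k).aestronglyMeasurable
      · simp [norm_ee]
    have h1 := hasSum_nat (parseval hG hu.bd.2.1) (by
      intro n hn
      simp [hu.bd.2.2.2 n hn])
    have h2 : ∫ x, conj (ee x ^ k * conj (F x)) * u (ee x) ∂mm
        = cf (fun x => u (ee x) * F x) k := by
      unfold cf
      congr 1
      ext x
      rw [map_mul, map_zpow₀, conj_ee, Complex.conj_conj, inv_zpow]
      ring
    rw [h2] at h1
    refine h1.congr_fun ?_
    intro n
    rw [mul_comm]
    congr 1
    rw [cf, cf, ← integral_conj]
    congr 1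
    ext x
    simp only [map_mul, map_inv₀, map_zpow₀, conj_ee, Complex.conj_conj, inv_zpow]
    rw [zpow_sub₀ (ee_ne_zero x)]
    have := ee_ne_zero x
    field_simp
  refine ⟨hu.diffOn.mul h.1, hu.mul_memLp h.2.1, ?_, ?_⟩
  · intro n
    rw [hcoeff_mul hu.diffOn h.1]
    refine (hc n).unique ?_
    have : ∑ i ∈ Finset.range (n + 1), hcoeff u i * hcoeff f (n - i)
        = ∑ i ∈ Finset.range (n + 1), cf (fun x => u (ee x)) i * cf F (n - i) := by
      refine Finset.sum_congr rfl fun i hi => ?_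
      have hi' : i ≤ n := by simpa [Nat.lt_succ_iff] using hi
      rw [hu.bd.2.2.1, ← h.2.2.1, Nat.cast_sub hi']
    rw [this]
    apply hasSum_sum_of_ne_finset_zero
    intro b hb
    have hb' : n < b := by simpa using hb
    rw [h.2.2.2 _ (by omega), mul_zero]
  · intro n hn
    refine (hc n).unique ?_
    convert hasSum_zero with i
    rw [h.2.2.2 _ (by omega), mul_zero]

lemma Bd.memK {u f : ℂ → ℂ} {F : Cc → ℂ} (hu : Nice u) (h : Bd f F) :
    MemK u f ↔ ∀ n : ℕ, ∫ x, conj (u (ee x) * ee x ^ n) * F x ∂mm = 0 := by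
  constructor
  · intro hK n
    have := hK.2 _ (nice_pow n).bd.memH2
    rwa [(Bd.mul hu (nice_pow n).bd).hinner h] at this
  · intro hn
    refine ⟨h.memH2, fun g hg => ?_⟩
    obtain ⟨G, hG⟩ := hg.exists_bd
    rw [(Bd.mul hu hG).hinner h]
    have hUF : MemLp (fun x => conj (u (ee x)) * F x) 2 mm := by
      refine h.2.1.mul (r := 2) (p := ⊤) ?_
      exact hu.memLp.star
    have h1 := parseval hG.2.1 hUF
    have h2 : ∀ n : ℤ, conj (cf G n) * cf (fun x => conj (u (ee x)) * F x) n = 0 := by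
      intro n
      rcases lt_or_ge n 0 with h0 | h0
      · simp [hG.2.2.2 n h0]
      · obtain ⟨m, rfl⟩ := Int.eq_ofNat_of_zero_le h0
        have : cf (fun x => conj (u (ee x)) * F x) m = 0 := by
          rw [← hn m, cf]
          congr 1
          ext x
          rw [map_mul, map_pow, conj_ee, zpow_natCast, inv_pow]
          ring
        rw [this, mul_zero]
    simp only [h2] at h1
    rw [← h1.unique hasSum_zero]
    congr 1
    ext x
    rw [map_mul]
    ring

lemma laplace_phi {x : Cc} (hx : ee x ≠ -1) :
    ∫ t in Set.Ioi (0 : ℝ), ((Real.exp (-t) : ℝ) : ℂ) * phi t (ee x) = (1 + ee x) / 2 := by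
  have h1 : 1 + ee x ≠ 0 := by
    intro h
    exact hx (by linear_combination h)
  have hs : ((1 - ee x) / (1 + ee x)).re = 0 := by
    rw [phi_re, norm_ee]
    simp
  have h2 := integral_exp_mul_complex_Ioi (a := -(1 + (1 - ee x) / (1 + ee x))) (by
    rw [Complex.neg_re, Complex.add_re, hs]
    simp) 0
  have h3 : -(1 + (1 - ee x) / (1 + ee x)) = -(2 / (1 + ee x)) := by
    field_simp
    ring
  calc _ = ∫ t in Set.Ioi (0 : ℝ), Complex.exp (-(1 + (1 - ee x) / (1 + ee x)) * t) := by
        congr 1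
        ext t
        rw [phi, Complex.ofReal_exp, ← Complex.exp_add]
        congr 1
        push_cast
        ring
    _ = _ := by
        rw [h2, h3]
        simp

lemma fubini_step {G : Cc → ℂ} (hG : Integrable G mm)
    (h : ∀ l : ℝ, 0 ≤ l → ∫ x, G x * phi l (ee x) ∂mm = 0) :
    ∀ l : ℝ, 0 ≤ l → ∫ x, (G x * ee x) * phi l (ee x) ∂mm = 0 := by
  intro l hl
  have hm : ∀ l : ℝ, Measurable fun x : Cc => phi l (ee x) := by
    intro l
    have := measurable_ee
    unfold phi
    fun_prop
  have hGp : Integrable (fun x => G x * phi l (ee x)) mm := by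
    refine hG.mul_bdd (c := 1) (hm l).aestronglyMeasurable (ae_of_all _ fun x => ?_)
    exact (norm_phi_ee l x).le
  have hexp : Integrable (fun t : ℝ => ((Real.exp (-t) : ℝ) : ℂ))
      (volume.restrict (Set.Ioi (0 : ℝ))) := by
    apply Integrable.ofReal
    have := integrableOn_exp_neg_Ioi 0
    exact this
  have hprod : Integrable (fun p : Cc × ℝ => (G p.1 * phi l (ee p.1)) *
      (((Real.exp (-p.2) : ℝ) : ℂ) * phi p.2 (ee p.1)))
      (mm.prod (volume.restrict (Set.Ioi (0 : ℝ)))) := by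
    have h1 := hGp.mul_prod hexp
    have h2 := h1.mul_bdd (c := 1) (g := fun p : Cc × ℝ => phi p.2 (ee p.1)) (by
      apply Measurable.aestronglyMeasurable
      have := measurable_ee
      unfold phi
      fun_prop) (ae_of_all _ fun p => (norm_phi_ee _ _).le)
    refine h2.congr (ae_of_all _ fun p => ?_)
    ring
  have hswap := integral_integral_swap (f := fun (x : Cc) (t : ℝ) => (G x * phi l (ee x)) *
      (((Real.exp (-t) : ℝ) : ℂ) * phi t (ee x))) hprod
  have hR : ∫ t in Set.Ioi (0 : ℝ), ∫ x, (G x * phi l (ee x)) *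
      (((Real.exp (-t) : ℝ) : ℂ) * phi t (ee x)) ∂mm = 0 := by
    rw [← integral_zero ℝ ℂ (μ := volume.restrict (Set.Ioi (0 : ℝ)))]
    refine setIntegral_congr_fun measurableSet_Ioi fun t ht => ?_
    have := h (l + t) (add_nonneg hl (le_of_lt ht))
    rw [← mul_zero ((Real.exp (-t) : ℝ) : ℂ), ← this, ← integral_const_mul]
    congr 1
    ext x
    rw [phi_add]
    ring
  rw [hR] at hswap
  have hL : ∫ x, (∫ t in Set.Ioi (0 : ℝ), (G x * phi l (ee x)) *
      (((Real.exp (-t) : ℝ) : ℂ) * phi t (ee x))) ∂mm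
      = ∫ x, ((1 / 2 : ℂ) * (G x * phi l (ee x)) +
        (1 / 2 : ℂ) * ((G x * ee x) * phi l (ee x))) ∂mm := by
    apply integral_congr_ae
    filter_upwards [ae_ee_ne] with x hx
    rw [integral_const_mul, laplace_phi hx]
    ring
  have hGe : Integrable (fun x => (G x * ee x) * phi l (ee x)) mm := by
    have := hGp.mul_bdd (c := 1) measurable_ee.aestronglyMeasurable
      (ae_of_all _ fun x => (norm_ee x).le)
    refine this.congr (ae_of_all _ fun p => ?_)
    ring
  rw [hL, integral_add (hGp.const_mul _) (hGe.const_mul _), integral_const_mul,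
    integral_const_mul, h l hl] at hswap
  simpa using hswap

lemma fubini_all {G : Cc → ℂ} (hG : Integrable G mm)
    (h : ∀ l : ℝ, 0 ≤ l → ∫ x, G x * phi l (ee x) ∂mm = 0) (n : ℕ) :
    ∫ x, G x * ee x ^ n ∂mm = 0 := by
  have key : ∀ n : ℕ, Integrable (fun x => G x * ee x ^ n) mm ∧
      ∀ l : ℝ, 0 ≤ l → ∫ x, (G x * ee x ^ n) * phi l (ee x) ∂mm = 0 := by
    intro n
    induction n with
    | zero => simpa using ⟨hG, h⟩
    | succ n ih =>
      have h2 := fubini_step ih.1 ih.2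
      have h1 := ih.1.mul_bdd (c := 1) measurable_ee.aestronglyMeasurable
        (ae_of_all _ fun x => (norm_ee x).le)
      simp only [pow_succ, ← mul_assoc]
      exact ⟨h1, h2⟩
  simpa [phi_zero] using (key n).2 0 le_rfl

lemma ee_pow_integral {G : Cc → ℂ} (n : ℕ) : ∫ x, G x * ee x ^ n ∂mm = cf G (-(n : ℤ)) := by
  unfold cf
  congr 1
  ext x
  rw [zpow_neg, inv_inv, zpow_natCast, mul_comm]

lemma summable_cf {G : Cc → ℂ} (hG : MemLp G 2 mm) : Summable fun n : ℤ => ‖cf G n‖ ^ 2 := by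
  have h := (Complex.hasSum_re (parseval hG hG)).summable
  refine h.congr fun n => ?_
  rw [← Complex.normSq_eq_conj_mul_self, Complex.ofReal_re, Complex.normSq_eq_norm_sq]

lemma outer_step {G : Cc → ℂ} (hG : MemLp G 2 mm) {w : ℂ} (hw : ‖w‖ = 1)
    (h : ∀ n : ℕ, ∫ x, G x * (ee x + w) * ee x ^ n ∂mm = 0) (n : ℕ) :
    ∫ x, G x * ee x ^ n ∂mm = 0 := by
  have hi : ∀ n : ℕ, Integrable (fun x => G x * ee x ^ n) mm := by
    intro n
    refine (integrable_of_memLp2 hG).mul_bdd (c := 1)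
      (measurable_ee.pow_const n).aestronglyMeasurable (ae_of_all _ fun x => ?_)
    simp [norm_ee]
  have hrec : ∀ n : ℕ, ∫ x, G x * ee x ^ (n + 1) ∂mm = - w * ∫ x, G x * ee x ^ n ∂mm := by
    intro n
    have h1 := h n
    have h2 : ∫ x, G x * (ee x + w) * ee x ^ n ∂mm
        = ∫ x, (G x * ee x ^ (n + 1) + w * (G x * ee x ^ n)) ∂mm := by
      congr 1
      ext x
      ring
    rw [h2, integral_add (hi _) ((hi _).const_mul _), integral_const_mul] at h1
    linear_combination h1
  have hnorm : ∀ m : ℕ, ‖∫ x, G x * ee x ^ m ∂mm‖ = ‖∫ x, G x * ee x ^ 0 ∂mm‖ := by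
    intro m
    induction m with
    | zero => rfl
    | succ m ih => rw [hrec, norm_mul, norm_neg, hw, one_mul, ih]
  have hs : Summable fun n : ℕ => ‖∫ x, G x * ee x ^ n ∂mm‖ ^ 2 := by
    have := (summable_cf hG).comp_injective (i := fun n : ℕ => -(n : ℤ))
      (fun a b hab => by simpa using hab)
    refine this.congr fun n => ?_
    rw [ee_pow_integral]
    rfl
  have ht := hs.tendsto_atTop_zero
  simp only [hnorm] at ht
  have h0 := tendsto_nhds_unique ht tendsto_const_nhds
  have : ‖∫ x, G x * ee x ^ 0 ∂mm‖ = 0 := by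
    have := h0.symm
    exact pow_eq_zero_iff (two_ne_zero) |>.mp this
  rw [← norm_eq_zero, hnorm n, this]

lemma outer_all {N : ℕ} (w : Fin N → ℂ) (hw : ∀ j, ‖w j‖ = 1) {G : Cc → ℂ} (hG : MemLp G 2 mm)
    (h : ∀ n : ℕ, ∫ x, (G x * ∏ j, (ee x + w j)) * ee x ^ n ∂mm = 0) (n : ℕ) :
    ∫ x, G x * ee x ^ n ∂mm = 0 := by
  induction N generalizing n with
  | zero => simpa using h n
  | succ N ih =>
    refine ih (fun j => w j.succ) (fun j => hw _) ?_ n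
    have hL : MemLp (fun x => G x * ∏ j : Fin N, (ee x + w j.succ)) 2 mm := by
      have := (nice_prod (fun j : Fin N => w j.succ)).mul_memLp hG
      simpa only [mul_comm] using this
    refine fun n => outer_step hL (hw 0) (fun m => ?_) n
    rw [← h m]
    congr 1
    ext x
    rw [Fin.prod_univ_succ]
    ring

lemma nice_sharp {N : ℕ} (w : Fin N → ℂ) : Nice (fun z => ∏ j, (1 + conj (w j) * z)) := by
  induction N with
  | zero => simpa using nice_const 1
  | succ n ih =>
    simp only [Fin.prod_univ_succ]
    refine Nice.mul ?_ (ih _)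
    refine ⟨fun _ _ => by fun_prop, ⟨1 + ‖conj (w 0)‖ * 1, fun z hz => ?_⟩, by fun_prop⟩
    refine (norm_add_le _ _).trans ?_
    rw [norm_mul, norm_one]
    gcongr

lemma sharp_eq {N : ℕ} (w : Fin N → ℂ) (x : Cc) :
    conj (ee x ^ N) * ∏ j, (ee x + w j) = conj (∏ j, (1 + conj (w j) * ee x)) := by
  rw [map_prod, map_pow]
  have : (conj (ee x)) ^ N = ∏ _j : Fin N, conj (ee x) := by simp
  rw [this, ← Finset.prod_mul_distrib]
  refine Finset.prod_congr rfl fun j _ => ?_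
  simp only [map_add, map_mul, map_one, Complex.conj_conj, conj_ee]
  have := ee_ne_zero x
  field_simp

lemma cf_prod_top {N : ℕ} (w : Fin N → ℂ) : cf (fun x => ∏ j, (ee x + w j)) N = 1 := by
  have h := (nice_sharp w).bd.2.2.1 0
  have h1 : cf (fun x => ∏ j, (ee x + w j)) N
      = conj (cf (fun x => ∏ j, (1 + conj (w j) * ee x)) 0) := by
    unfold cf
    rw [← integral_conj]
    congr 1
    ext x
    rw [zpow_natCast, zpow_zero, inv_one, one_mul, ← sharp_eq, map_pow, conj_ee, inv_pow]
  rw [h1]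
  have h2 : cf (fun x => ∏ j, (1 + conj (w j) * ee x)) 0 = 1 := by
    have h' := h
    simp only [Nat.cast_zero] at h'
    rw [h']
    simp [hcoeff]
  rw [h2, map_one]

lemma phi_conj_mul {l d : ℝ} (x : Cc) :
    conj (phi d (ee x)) * phi l (ee x) = conj (phi (d - l) (ee x)) := by
  have h1 : phi d (ee x) = phi l (ee x) * phi (d - l) (ee x) := by
    rw [← phi_add]
    congr 1
    ring
  have h2 : conj (phi l (ee x)) * phi l (ee x) = 1 := by
    rw [← Complex.normSq_eq_conj_mul_self, Complex.normSq_eq_norm_sq, norm_phi_ee]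
    simp
  rw [h1, map_mul]
  linear_combination conj (phi (d - l) (ee x)) * h2

lemma nice_u {δ : ℝ} (hδ : 0 ≤ δ) (N : ℕ) : Nice (fun z => z ^ (N + 1) * phi δ z) :=
  (nice_pow _).mul (nice_phi hδ)

lemma nice_P {l : ℝ} (hl : 0 ≤ l) {N : ℕ} (w : Fin N → ℂ) :
    Nice (fun z => (∏ j, (z + w j)) * phi l z) :=
  (nice_prod w).mul (nice_phi hl)

lemma memK_P {δ l : ℝ} (hl : 0 ≤ l) (hlδ : l ≤ δ) {N : ℕ} (w : Fin N → ℂ) :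
    MemK (fun z => z ^ (N + 1) * phi δ z) (fun z => (∏ j, (z + w j)) * phi l z) := by
  rw [Bd.memK (nice_u (hl.trans hlδ) N) (nice_P hl w).bd]
  intro n
  have hv : Nice (fun z => (∏ j, (1 + conj (w j) * z)) * phi (δ - l) z) :=
    (nice_sharp w).mul (nice_phi (sub_nonneg.mpr hlδ))
  have h := hv.bd.2.2.2 (-((n + 1 : ℕ) : ℤ)) (by push_cast; omega)
  rw [← ee_pow_integral] at h
  rw [← map_zero conj, ← h, ← integral_conj]
  congr 1
  ext x
  have e1 := sharp_eq w x
  have e2 := phi_conj_mul (l := l) (d := δ) x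
  simp only [map_mul, map_pow] at *
  rw [← e1, ← e2]
  ring

lemma memK_phi_mul {δ : ℝ} (hδ : 0 ≤ δ) {N : ℕ} {q : ℂ → ℂ} {Q : Cc → ℂ} (h : Bd q Q)
    (h0 : ∀ n : ℕ, cf Q ((N + n : ℕ) : ℤ) = 0) :
    MemK (fun z => z ^ (N + 1) * phi δ z) (fun z => phi δ z * q z) := by
  rw [Bd.memK (nice_u hδ N) (Bd.mul (nice_phi hδ) h)]
  intro n
  rw [← h0 (1 + n), cf]
  congr 1
  ext x
  have e2 := phi_conj_mul (l := δ) (d := δ) x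
  rw [sub_self, phi_zero, map_one] at e2
  rw [zpow_natCast]
  simp only [map_mul, map_pow, conj_ee, inv_pow]
  linear_combination ((ee x ^ (N + 1))⁻¹ * (ee x ^ n)⁻¹ * Q x) * e2


/-- Generators of the closed span. -/
noncomputable def VP (δ : ℝ) {N : ℕ} (w : Fin N → ℂ) (l : Set.Icc (0 : ℝ) δ) : Lp ℂ 2 mm :=
  (nice_P l.2.1 w).bd.2.1.toLp _

/-- The closed span on the boundary. -/
noncomputable def CC (δ : ℝ) {N : ℕ} (w : Fin N → ℂ) : Submodule ℂ (Lp ℂ 2 mm) :=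
  (Submodule.span ℂ (Set.range (VP δ w))).topologicalClosure

lemma toLp_sum {n : ℕ} (F : Fin n → Cc → ℂ) (hF : ∀ i, MemLp (F i) 2 mm)
    (h : MemLp (∑ i, F i) 2 mm) : h.toLp _ = ∑ i, (hF i).toLp (F i) := by
  induction n with
  | zero =>
    have e : h.toLp _ = (MemLp.zero (ε := ℂ) (p := 2) (μ := mm)).toLp _ :=
      MemLp.toLp_congr _ _ (by simp)
    rw [e, Fin.sum_univ_zero]
    exact MemLp.toLp_zero _
  | succ n ih =>
    have h' : MemLp (∑ i : Fin n, F i.succ) 2 mm := memLp_finsetSum' _ fun i _ => hF _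
    have e : h.toLp _ = ((hF 0).add h').toLp _ :=
      MemLp.toLp_congr _ _ (by rw [Fin.sum_univ_succ])
    rw [e, MemLp.toLp_add (hF 0) h', ih (fun i => F i.succ) (fun i => hF _) h']
    exact (Fin.sum_univ_succ (fun i => (hF i).toLp (F i))).symm

lemma dist_formula {δ : ℝ} {N : ℕ} (w : Fin N → ℂ) {g : ℂ → ℂ} {G : Cc → ℂ} (h : Bd g G)
    {n : ℕ} (c : Fin n → ℂ) (l : Fin n → Set.Icc (0 : ℝ) δ) :
    hnormSq (fun z => g z - ∑ i, c i * ((∏ j, (z + w j)) * phi (l i) z))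
      = ‖h.2.1.toLp G - ∑ i, c i • VP δ w (l i)‖ ^ 2 := by
  have h1 := Bd.sum _ _ (fun i => ((nice_P (l i).2.1 w).bd).const_mul (c i))
  have h2 := h.sub h1
  rw [h2.hnormSq, MemLp.toLp_sub h.2.1 h1.2.1,
    toLp_sum _ (fun i => (((nice_P (l i).2.1 w).bd).const_mul (c i)).2.1)]
  rfl

lemma inClosedSpan_iff {δ : ℝ} {N : ℕ} (w : Fin N → ℂ) {g : ℂ → ℂ} {G : Cc → ℂ} (h : Bd g G) :
    InClosedSpan (fun lam z => (∏ j, (z + w j)) * phi lam z) (Set.Icc 0 δ) g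
      ↔ h.2.1.toLp G ∈ CC δ w := by
  rw [CC, ← SetLike.mem_coe, Submodule.topologicalClosure_coe, Metric.mem_closure_iff]
  constructor
  · rintro ⟨-, hg⟩ ε hε
    obtain ⟨n, c, lam, hlam, hlt⟩ := hg (ε ^ 2) (by positivity)
    let l : Fin n → Set.Icc (0 : ℝ) δ := fun i => ⟨lam i, hlam i⟩
    refine ⟨∑ i, c i • VP δ w (l i), ?_, ?_⟩
    · exact Submodule.sum_mem _ fun i _ => Submodule.smul_mem _ _
        (Submodule.subset_span ⟨l i, rfl⟩)
    · rw [dist_eq_norm]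
      have := dist_formula w h c l
      have h3 : ‖h.2.1.toLp G - ∑ i, c i • VP δ w (l i)‖ ^ 2 < ε ^ 2 := by
        rw [← this]
        exact hlt
      exact lt_of_pow_lt_pow_left₀ 2 hε.le h3
  · intro hg
    refine ⟨h.memH2, fun ε hε => ?_⟩
    obtain ⟨b, hb, hd⟩ := hg (Real.sqrt ε) (Real.sqrt_pos.mpr hε)
    obtain ⟨n, c, v, rfl⟩ := Submodule.mem_span_set'.mp hb
    choose l hl using fun i => (v i).2
    refine ⟨n, c, fun i => l i, fun i => (l i).2, ?_⟩
    have := dist_formula w h c l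
    simp only
    rw [this]
    simp only [hl]
    rw [dist_eq_norm] at hd
    calc _ < (Real.sqrt ε) ^ 2 := by gcongr
      _ = ε := Real.sq_sqrt hε.le

/-- Vectors defining the model space on the boundary. -/
noncomputable def RR (u : ℂ → ℂ) (hu : Nice u) : Set (Lp ℂ 2 mm) :=
  Set.range (fun n : {n : ℤ // n < 0} => (fourierBasis (T := 1)) n.1) ∪
  Set.range (fun n : ℕ => (hu.mul (nice_pow n)).bd.2.1.toLp _)

/-- The model space on the boundary. -/
noncomputable def KK (u : ℂ → ℂ) (hu : Nice u) : Submodule ℂ (Lp ℂ 2 mm) :=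
  (Submodule.span ℂ (RR u hu))ᗮ

lemma mem_KK_iff {u : ℂ → ℂ} (hu : Nice u) {F : Cc → ℂ} (hF : MemLp F 2 mm) :
    hF.toLp F ∈ KK u hu ↔ (∀ n : ℤ, n < 0 → cf F n = 0) ∧
      ∀ n : ℕ, ∫ x, conj (u (ee x) * ee x ^ n) * F x ∂mm = 0 := by
  have h1 : hF.toLp F ∈ KK u hu ↔ ∀ r ∈ RR u hu, inner ℂ r (hF.toLp F) = 0 := by
    rw [KK, Submodule.mem_orthogonal]
    constructor
    · exact fun h r hr => h r (Submodule.subset_span hr)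
    · intro h r hr
      induction hr using Submodule.span_induction with
      | mem x hx => exact h x hx
      | zero => simp
      | add x y _ _ hx hy => rw [inner_add_left, hx, hy, add_zero]
      | smul a x _ hx => rw [inner_smul_left, hx, mul_zero]
  rw [h1]
  simp only [RR, Set.mem_union, or_imp, forall_and, Set.forall_mem_range, Subtype.forall]
  refine and_congr ?_ ?_
  · refine forall_congr' fun n => forall_congr' fun hn => ?_
    rw [← repr_toLp hF, HilbertBasis.repr_apply_apply]
  · refine forall_congr' fun n => ?_
    rw [inner_toLp]

lemma Bd.memK_iff_KK {u f : ℂ → ℂ} {F : Cc → ℂ} (hu : Nice u) (h : Bd f F) :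
    MemK u f ↔ h.2.1.toLp F ∈ KK u hu := by
  rw [h.memK hu, mem_KK_iff]
  exact ⟨fun h' => ⟨h.2.2.2, h'⟩, fun h' => h'.2⟩

lemma KK_isClosed {u : ℂ → ℂ} (hu : Nice u) : IsClosed (KK u hu : Set (Lp ℂ 2 mm)) :=
  Submodule.isClosed_orthogonal _

lemma CC_le {δ : ℝ} (hδ : 0 ≤ δ) {N : ℕ} (w : Fin N → ℂ) :
    CC δ w ≤ KK _ (nice_u hδ N) := by
  refine Submodule.topologicalClosure_minimal _ ?_ (KK_isClosed _)
  rw [Submodule.span_le]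
  rintro _ ⟨l, rfl⟩
  exact ((nice_P l.2.1 w).bd.memK_iff_KK _).mp (memK_P l.2.1 l.2.2 w)

lemma nice_D {δ : ℝ} (hδ : 0 ≤ δ) (k : ℕ) : Nice (fun z => phi δ z * z ^ k) :=
  (nice_phi hδ).mul (nice_pow k)

/-- The finite-dimensional part. -/
noncomputable def DD {δ : ℝ} (hδ : 0 ≤ δ) (N : ℕ) (k : Fin N) : Lp ℂ 2 mm :=
  (nice_D hδ k).bd.2.1.toLp _

lemma cf_npow (k : ℕ) (n : ℤ) : cf (fun x => ee x ^ k) n = if (k : ℤ) = n then 1 else 0 := by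
  rw [← cf_pow]
  simp only [zpow_natCast]

lemma DD_mem {δ : ℝ} (hδ : 0 ≤ δ) (N : ℕ) (k : Fin N) : DD hδ N k ∈ KK _ (nice_u hδ N) := by
  refine ((nice_D hδ k).bd.memK_iff_KK _).mp (memK_phi_mul hδ (nice_pow k).bd fun n => ?_)
  rw [cf_npow, if_neg]
  have := k.2
  push_cast
  omega

lemma key_zero {δ : ℝ} (hδ : 0 ≤ δ) {N : ℕ} (w : Fin N → ℂ) (hw : ∀ j, ‖w j‖ = 1)
    {Y : Cc → ℂ} (hY : MemLp Y 2 mm) (hK : hY.toLp Y ∈ KK _ (nice_u hδ N))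
    (hV : ∀ l, inner ℂ (hY.toLp Y) (VP δ w l) = 0)
    (hD : ∀ k, inner ℂ (DD hδ N k) (hY.toLp Y) = 0) : hY.toLp Y = 0 := by
  rw [mem_KK_iff] at hK
  obtain ⟨hK1, hK2⟩ := hK
  simp only [VP, inner_toLp] at hV
  simp only [DD, inner_toLp] at hD
  have hY' : MemLp (fun x => conj (phi δ (ee x)) * Y x) 2 mm :=
    hY.mul (r := 2) (nice_phi hδ).memLp.star
  have hcf : ∀ n : ℕ, n ≠ N → cf (fun x => conj (phi δ (ee x)) * Y x) n = 0 := by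
    intro n hn
    rcases lt_or_gt_of_ne hn with h | h
    · rw [← hD ⟨n, h⟩, cf]
      congr 1
      ext x
      simp only [map_mul, map_pow, conj_ee, zpow_natCast, inv_pow]
      ring
    · obtain ⟨m, rfl⟩ := Nat.exists_eq_add_of_le h
      rw [← hK2 m, cf]
      congr 1
      ext x
      simp only [map_mul, map_pow, conj_ee, zpow_natCast, inv_pow, Nat.succ_eq_add_one]
      ring
  have hv : ∀ v, Nice v → ∫ x, conj (Y x) * (phi δ (ee x) * v (ee x)) ∂mm
      = conj (cf (fun x => conj (phi δ (ee x)) * Y x) N) * cf (fun x => v (ee x)) N := by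
    intro v hv
    have h1 := parseval hY' hv.bd.2.1
    have h2 := h1.unique (hasSum_single (N : ℤ) (by
      intro n hn
      rcases lt_or_ge n 0 with h0 | h0
      · rw [hv.bd.2.2.2 n h0, mul_zero]
      · obtain ⟨m, rfl⟩ := Int.eq_ofNat_of_zero_le h0
        rw [hcf m (by simpa using hn), map_zero, zero_mul]))
    rw [← h2]
    congr 1
    ext x
    rw [map_mul, Complex.conj_conj]
    ring
  have hN : conj (cf (fun x => conj (phi δ (ee x)) * Y x) N) = 0 := by
    have h1 := hv _ (nice_prod w)
    rw [cf_prod_top, mul_one] at h1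
    rw [← h1, ← hV ⟨δ, hδ, le_rfl⟩]
    congr 1
    ext x
    ring
  have hall : ∀ l : ℝ, 0 ≤ l →
      ∫ x, (conj (Y x) * ∏ j, (ee x + w j)) * phi l (ee x) ∂mm = 0 := by
    intro l hl
    rcases le_total l δ with h | h
    · rw [← hV ⟨l, hl, h⟩]
      congr 1
      ext x
      ring
    · have h1 := hv _ (nice_P (sub_nonneg.mpr h) w)
      rw [hN, zero_mul] at h1
      rw [← h1]
      congr 1
      ext x
      have : phi l (ee x) = phi δ (ee x) * phi (l - δ) (ee x) := by
        rw [← phi_add]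
        congr 1
        ring
      rw [this]
      ring
  have hYint : Integrable (fun x => conj (Y x) * ∏ j, (ee x + w j)) mm := by
    have := integrable_of_memLp2 ((nice_prod w).mul_memLp hY.star)
    refine this.congr (ae_of_all _ fun x => ?_)
    simp only [Pi.star_apply, RCLike.star_def]
    ring
  have h3 := outer_all w hw (G := fun x => conj (Y x)) hY.star (fubini_all hYint hall)
  have hz : ∀ n : ℤ, cf Y n = 0 := by
    intro n
    rcases lt_or_ge n 0 with h0 | h0
    · exact hK1 n h0
    · obtain ⟨m, rfl⟩ := Int.eq_ofNat_of_zero_le h0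
      rw [← map_zero conj, ← h3 m, ← integral_conj, cf]
      congr 1
      ext x
      simp only [map_mul, map_pow, conj_ee, zpow_natCast, inv_pow, Complex.conj_conj]
      ring
  apply (fourierBasis (T := 1)).repr.injective
  ext n
  rw [repr_toLp, hz]
  simp

lemma KK_le {δ : ℝ} (hδ : 0 ≤ δ) {N : ℕ} (w : Fin N → ℂ) (hw : ∀ j, ‖w j‖ = 1) :
    KK _ (nice_u hδ N) ≤ CC δ w ⊔ Submodule.span ℂ (Set.range (DD hδ N)) := by
  set D := Submodule.span ℂ (Set.range (DD hδ N)) with hDdef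
  have : FiniteDimensional ℂ D := FiniteDimensional.span_of_finite ℂ (Set.finite_range _)
  have hcl : IsClosed ((CC δ w ⊔ D : Submodule ℂ (Lp ℂ 2 mm)) : Set (Lp ℂ 2 mm)) :=
    Submodule.isClosed_sup_finiteDimensional _ _ (Submodule.isClosed_topologicalClosure _)
  have : CompleteSpace (CC δ w ⊔ D : Submodule ℂ (Lp ℂ 2 mm)) := hcl.completeSpace_coe
  have hle : CC δ w ⊔ D ≤ KK _ (nice_u hδ N) := by
    refine sup_le (CC_le hδ w) ?_
    rw [hDdef, Submodule.span_le]
    rintro _ ⟨k, rfl⟩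
    exact DD_mem hδ N k
  intro X hX
  obtain ⟨a, ha, b, hb, rfl⟩ := Submodule.exists_add_mem_mem_orthogonal (K := CC δ w ⊔ D) X
  have hbK : b ∈ KK _ (nice_u hδ N) := by
    have := Submodule.sub_mem _ hX (hle ha)
    simpa using this
  have hb0 : b = 0 := by
    have hbb : (Lp.memLp b).toLp b = b := Lp.toLp_coeFn b _
    rw [← hbb]
    refine key_zero hδ w hw (Lp.memLp b) ?_ ?_ ?_
    · rwa [hbb]
    · intro l
      rw [hbb]
      refine Submodule.inner_left_of_mem_orthogonal ?_ hb
      exact Submodule.mem_sup_left (Submodule.le_topologicalClosure _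
        (Submodule.subset_span ⟨l, rfl⟩))
    · intro k
      rw [hbb]
      refine Submodule.inner_right_of_mem_orthogonal ?_ hb
      exact Submodule.mem_sup_right (Submodule.subset_span ⟨k, rfl⟩)
  rw [hb0, add_zero]
  exact ha

lemma memK_pow_bd {N : ℕ} {q : ℂ → ℂ} {Q : Cc → ℂ} (h : Bd q Q) :
    MemK (fun z => z ^ N) q ↔ ∀ n : ℕ, cf Q ((N + n : ℕ) : ℤ) = 0 := by
  rw [h.memK (nice_pow N)]
  refine forall_congr' fun n => ?_
  rw [cf]
  have : ∀ x, conj (ee x ^ N * ee x ^ n) * Q x = (ee x ^ ((N + n : ℕ) : ℤ))⁻¹ * Q x := by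
    intro x
    rw [zpow_natCast, ← pow_add, map_pow, conj_ee, inv_pow]
  simp only [this]

/-- For p̃_N(z) = ∏_{j=1}^N (z + w_j) with w_j ∈ 𝕋 and c(p̃_N) the closed span of
{p̃_N φ^λ : 0 ≤ λ ≤ δ} in H²(𝔻): c(p̃_N) + φ^δ K_{z^N} = K_{z^{N+1}φ^δ};
in particular c(p̃_N) has codimension at most N in K_{z^{N+1}φ^δ}. -/
theorem stmt18 (δ : ℝ) (hδ : 0 < δ) (N : ℕ) (hN : 1 ≤ N)
    (w : Fin N → ℂ) (hw : ∀ j, ‖w j‖ = 1) :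
    ∀ f, (∃ g q : ℂ → ℂ,
        InClosedSpan (fun lam z => (∏ j, (z + w j)) * phi lam z) (Set.Icc 0 δ) g ∧
        MemK (fun z => z ^ N) q ∧
        ∀ z, f z = g z + phi δ z * q z)
      ↔ MemK (fun z => z ^ (N + 1) * phi δ z) f := by
  intro f
  have hδ' := hδ.le
  constructor
  · rintro ⟨g, q, hg, hq, hf⟩
    obtain ⟨G, hG⟩ := hg.1.exists_bd
    obtain ⟨Q, hQ⟩ := hq.1.exists_bd
    have h1 := CC_le hδ' w ((inClosedSpan_iff w hG).mp hg)
    have hB := Bd.mul (nice_phi hδ') hQ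
    have h2 := (hB.memK_iff_KK (nice_u hδ' N)).mp (memK_phi_mul hδ' hQ ((memK_pow_bd hQ).mp hq))
    have hfe : f = fun z => g z + phi δ z * q z := funext hf
    rw [hfe, (hG.add hB).memK_iff_KK (nice_u hδ' N), MemLp.toLp_add hG.2.1 hB.2.1]
    exact Submodule.add_mem _ h1 h2
  · intro hf
    obtain ⟨F, hF⟩ := hf.1.exists_bd
    have h1 := KK_le hδ' w hw ((hF.memK_iff_KK (nice_u hδ' N)).mp hf)
    obtain ⟨a, ha, b, hb, hab⟩ := Submodule.mem_sup.mp h1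
    obtain ⟨c, hc⟩ := (Submodule.mem_span_range_iff_exists_fun ℂ).mp hb
    have hq := Bd.sum _ _ (fun k : Fin N => ((nice_pow (k : ℕ)).bd.const_mul (c k)))
    have hs := Bd.sum _ _ (fun k : Fin N => ((nice_D hδ' (k : ℕ)).bd.const_mul (c k)))
    have hsb : hs.2.1.toLp _ = b := by
      rw [← hc, toLp_sum _ (fun k : Fin N => ((nice_D hδ' (k : ℕ)).bd.const_mul (c k)).2.1)]
      rfl
    have hg := hF.sub hs
    refine ⟨_, fun z => ∑ k : Fin N, c k * z ^ (k : ℕ), (inClosedSpan_iff w hg).mpr ?_,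
      (memK_pow_bd hq).mpr ?_, ?_⟩
    · rw [MemLp.toLp_sub hF.2.1 hs.2.1, hsb, ← hab]
      simpa using ha
    · intro n
      rw [hq.2.2.1]
      have h0 : ∀ k : Fin N, hcoeff (fun z => c k * z ^ (k : ℕ)) (N + n) = 0 := by
        intro k
        rw [hcoeff_const_mul, ← (nice_pow (k : ℕ)).bd.2.2.1, cf_npow, if_neg, mul_zero]
        have := k.2
        push_cast
        omega
      have hcs := congrFun (fourierCoeff.sum (T := 1) Finset.univ
        (fun k : Fin N => c k • fun x : Cc => ee x ^ (k : ℕ)) (fun k _ =>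
          integrable_of_memLp2 (((nice_pow (k : ℕ)).bd.const_mul (c k)).2.1))) ((N + n : ℕ) : ℤ)
      rw [← cf_eq, hq.2.2.1, Finset.sum_apply] at hcs
      rw [hcs]
      refine Finset.sum_eq_zero fun k _ => ?_
      rw [← cf_eq, ((nice_pow (k : ℕ)).bd.const_mul (c k)).2.2.1, h0]
    · intro z
      have : ∑ k : Fin N, c k * (phi δ z * z ^ (k : ℕ))
          = phi δ z * ∑ k : Fin N, c k * z ^ (k : ℕ) := by
        rw [Finset.mul_sum]
        refine Finset.sum_congr rfl fun k _ => ?_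
        ring
      rw [← this]
      ring
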